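/- arXiv:2007.00033 — 2 statements merged into one kernel-verified Lean document; each statement's English description precedes it below -/
import Mathlib

section
/- Let m be a positive integer and let valid₃ = { enc₃(z) : z ∈ {−1,0,1}^m } ⊆ {−1,0,1}^{3m}. Then enc₃ is injective (so valid₃ has exactly 3^m elements), and for every fixed v ∈ valid₃ the map b ↦ φ′_b(v) is a bijection from {−1,0,1}^m onto valid₃; consequently, if v ∈ valid₃ and b is chosen uniformly at random from {−1,0,1}^m, then φ′_b(v) is uniformly distributed on valid₃. -/
/-- `[a]₃`: the unique element of `{-1, 0, 1}` congruent to `a` modulo `3`. -/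
def bal3 (a : ℤ) : ℤ := if a % 3 = 2 then -1 else a % 3

/-- The slot (of a block of three coordinates, labelled `-1, 0, 1` in order)
corresponding to the residue `[c]₃`. -/
def slot3 (c : ℤ) : Fin 3 := if bal3 c = -1 then 0 else if bal3 c = 0 then 1 else 2

/-- `enc₃(z)`: the entry in slot `(i, j)` (slot `j` carrying label `c = j - 1`)
equals `[z_i − c]₃`. -/
def enc3 {m : ℕ} (z : Fin m → ℤ) : Fin m × Fin 3 → ℤ :=
  fun p => bal3 (z p.1 - ((p.2 : ℤ) - 1))

/-- The permutation `φ′_b`: the entry of `φ′_b(v)` at label `c` is `v_i^{([c - b_i]₃)}`. -/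
def phi3 {m : ℕ} (b : Fin m → ℤ) (v : Fin m × Fin 3 → ℤ) : Fin m × Fin 3 → ℤ :=
  fun p => v (p.1, slot3 (((p.2 : ℤ) - 1) - b p.1))

/-- The set `{-1,0,1}^m` of ternary vectors. -/
def trit (m : ℕ) : Set (Fin m → ℤ) := {z | ∀ i, z i = -1 ∨ z i = 0 ∨ z i = 1}

/-- `{-1,0,1}^m` as a `Finset`. -/
def tritFinset (m : ℕ) : Finset (Fin m → ℤ) :=
  Fintype.piFinset fun _ : Fin m => ({-1, 0, 1} : Finset ℤ)

/-- `valid₃ = { enc₃(z) : z ∈ {-1,0,1}^m }`. -/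
def valid3 (m : ℕ) : Set (Fin m × Fin 3 → ℤ) := enc3 '' trit m

theorem bal3_mem (a : ℤ) : bal3 a = -1 ∨ bal3 a = 0 ∨ bal3 a = 1 := by
  unfold bal3
  split_ifs <;> omega

theorem bal3_sub_slot3 (a c : ℤ) : bal3 (a - ((slot3 c : ℤ) - 1)) = bal3 (a - c) := by
  unfold slot3
  split_ifs with h₁ h₂ <;> unfold bal3 at * <;> simp <;> grind

theorem phi3_enc3 {m : ℕ} (b z : Fin m → ℤ) :
    phi3 b (enc3 z) = enc3 fun i => bal3 (z i + b i) := by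
  funext p
  simp only [phi3, enc3, bal3_sub_slot3]
  unfold bal3
  grind

theorem enc3_injOn (m : ℕ) : Set.InjOn (enc3 (m := m)) (trit m) := by
  intro z hz w hw h
  funext i
  have hi := congrFun h (i, 1)
  have hzi := hz i
  have hwi := hw i
  simp only [enc3, bal3] at hi
  simp at hi
  grind

theorem coe_tritFinset (m : ℕ) : (tritFinset m : Set (Fin m → ℤ)) = trit m := by
  ext z
  simp [tritFinset, trit]

theorem bijOn_phi3 {m : ℕ} {v : Fin m × Fin 3 → ℤ} (hv : v ∈ valid3 m) :
    Set.BijOn (fun b => phi3 b v) (trit m) (valid3 m) := by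
  obtain ⟨z, hz, rfl⟩ := hv
  refine ⟨fun b _ => ?_, fun b hb c hc h => ?_, ?_⟩
  · exact ⟨_, fun i => bal3_mem _, (phi3_enc3 b z).symm⟩
  · simp only [phi3_enc3] at h
    have h' := enc3_injOn m (fun i => bal3_mem _) (fun i => bal3_mem _) h
    funext i
    have hi := congrFun h' i
    have hbi := hb i
    have hci := hc i
    simp only [bal3] at hi
    grind
  · rintro _ ⟨w, hw, rfl⟩
    refine ⟨fun i => bal3 (w i - z i), fun i => bal3_mem _, ?_⟩
    simp only [phi3_enc3]
    congr 1
    funext i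
    have hwi := hw i
    simp only [bal3]
    grind

theorem PMF.map_uniformOfFinset_of_bijOn {α β : Type*} {f : α → β}
    {s : Finset α} (hs : s.Nonempty) {t : Finset β} (ht : t.Nonempty)
    (hf : Set.BijOn f s t) :
    PMF.map f (PMF.uniformOfFinset s hs) = PMF.uniformOfFinset t ht := by
  classical
  have himg : s.image f = t := by
    rw [← Finset.coe_inj, Finset.coe_image, hf.image_eq]
  have hcard : t.card = s.card := by
    rw [← himg, Finset.card_image_of_injOn hf.injOn]
  ext y
  rw [PMF.map_apply, PMF.uniformOfFinset_apply]
  split_ifs with hy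
  · obtain ⟨x, hx, rfl⟩ := hf.surjOn hy
    rw [tsum_eq_single x]
    · simp [Finset.mem_coe.mp hx, hcard]
    · intro x' hne
      by_cases hx' : x' ∈ s
      · exact if_neg fun h => hne (hf.injOn hx' hx h.symm)
      · simp [hx']
  · refine ENNReal.tsum_eq_zero.mpr fun x => ?_
    by_cases hx : x ∈ s
    · exact if_neg (by rintro rfl; exact hy (hf.mapsTo hx))
    · simp [hx]

/-- `enc₃` is injective on `{-1,0,1}^m` (so `valid₃` has exactly `3^m` elements),
and for every fixed `v ∈ valid₃` the map `b ↦ φ′_b(v)` is a bijection from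
`{-1,0,1}^m` onto `valid₃`; consequently, if `v ∈ valid₃` and `b` is uniform on
`{-1,0,1}^m`, then `φ′_b(v)` is uniformly distributed on `valid₃`. -/
theorem enc3_injective_phi3_bijective_uniform (m : ℕ) (hm : 0 < m) :
    Set.InjOn (enc3 (m := m)) (trit m) ∧
    Nat.card (valid3 m) = 3 ^ m ∧
    ∀ v ∈ valid3 m,
      Set.BijOn (fun b => phi3 b v) (trit m) (valid3 m) ∧
      ∀ (hT : (tritFinset m).Nonempty)
        (hV : ((tritFinset m).image (enc3 (m := m))).Nonempty),
        PMF.map (fun b => phi3 b v) (PMF.uniformOfFinset (tritFinset m) hT) =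
          PMF.uniformOfFinset ((tritFinset m).image (enc3 (m := m))) hV := by
  refine ⟨enc3_injOn m, ?_, fun v hv => ⟨bijOn_phi3 hv, fun hT hV => ?_⟩⟩
  · rw [valid3, Nat.card_image_of_injOn (enc3_injOn m), ← coe_tritFinset]
    rw [Nat.card_eq_card_toFinset, Finset.toFinset_coe, tritFinset, Fintype.card_piFinset]
    simp
  · refine PMF.map_uniformOfFinset_of_bijOn hT hV ?_
    rw [Finset.coe_image, coe_tritFinset]
    exact bijOn_phi3 hv
end

section
/- Let m₁, m₂ be positive integers. For all t, b ∈ {0,1}^{m₁}, all z, e ∈ {−1,0,1}^{m₂}, and all v ∈ ℤ^{6m₁m₂}: v = Ext(mix(t, z)) if and only if Ψ_{b,e}(v) = Ext(mix(t ⊕ b, [z + e]₃)). -/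
/-- The bit `[a]₂ ∈ {0,1}` congruent to `a` modulo `2`. -/
def bal2 (a : ℤ) : ℤ := a % 2

/-- Slot of a block of two (labelled `0, 1`) corresponding to `[c]₂`. -/
def slot2 (c : ℤ) : Fin 2 := if bal2 c = 1 then 1 else 0

/-- `ext(t, z) ∈ ℤ^6`: entry at `(s, c)` is `[z − c]₃` if `s = t`, else `0`. -/
def ext (t z : ℤ) : Fin 2 × Fin 3 → ℤ :=
  fun p => if (p.1 : ℤ) = t then bal3 (z - ((p.2 : ℤ) - 1)) else 0

/-- `ψ_{b,e}`: entry at `(s, c)` is `v^{([s+b]₂, [c−e]₃)}`. -/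
def psi (b e : ℤ) (v : Fin 2 × Fin 3 → ℤ) : Fin 2 × Fin 3 → ℤ :=
  fun p => v (slot2 ((p.1 : ℤ) + b), slot3 (((p.2 : ℤ) - 1) - e))

/-- `Ext(mix(t, z)) ∈ ℤ^{6 m₁ m₂}`: the `(i, j)`-block (blocks ordered first by `i`
then by `j`) is `ext(t_i, z_j)`. -/
def ExtMix {m₁ m₂ : ℕ} (t : Fin m₁ → ℤ) (z : Fin m₂ → ℤ) :
    Fin m₁ × Fin m₂ × Fin 2 × Fin 3 → ℤ :=
  fun p => ext (t p.1) (z p.2.1) p.2.2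

/-- The permutation `Ψ_{b,e}` of `ℤ^{6 m₁ m₂}`, acting blockwise: the `(i, j)`-block
of `Ψ_{b,e}(v)` is `ψ_{b_i, e_j}(v_{i,j})`. -/
def PsiMix {m₁ m₂ : ℕ} (b : Fin m₁ → ℤ) (e : Fin m₂ → ℤ)
    (v : Fin m₁ × Fin m₂ × Fin 2 × Fin 3 → ℤ) :
    Fin m₁ × Fin m₂ × Fin 2 × Fin 3 → ℤ :=
  fun p => psi (b p.1) (e p.2.1) (fun q => v (p.1, p.2.1, q)) p.2.2

theorem slot2_coe (c : ℤ) : ((slot2 c : ℕ) : ℤ) = bal2 c := by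
  unfold slot2
  split_ifs <;> simp [bal2] at * <;> omega

theorem slot3_coe (c : ℤ) : ((slot3 c : ℕ) : ℤ) - 1 = bal3 c := by
  unfold slot3 bal3
  split_ifs <;> simp at * <;> omega

theorem slot2_slot2_add (b : ℤ) (s : Fin 2) : slot2 ((slot2 (s + b) : ℕ) + b) = s := by
  apply Fin.ext
  zify
  rw [slot2_coe, slot2_coe]
  unfold bal2
  omega

theorem slot3_slot3_sub (e : ℤ) (c : Fin 3) :
    slot3 ((slot3 ((c : ℤ) - 1 - -e) : ℕ) - 1 - e) = c := by
  apply Fin.ext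
  zify
  rw [← sub_left_inj (a := (1 : ℤ)), slot3_coe, slot3_coe]
  unfold bal3
  split_ifs <;> omega

theorem psi_neg_psi (b e : ℤ) (v : Fin 2 × Fin 3 → ℤ) : psi b (-e) (psi b e v) = v := by
  funext p
  simp only [psi, slot2_slot2_add, slot3_slot3_sub]

theorem psi_injective (b e : ℤ) : Function.Injective (psi b e) :=
  Function.LeftInverse.injective (psi_neg_psi b e)

theorem psi_ext {t : ℤ} (ht : t = 0 ∨ t = 1) (b z e : ℤ) :
    psi b e (ext t z) = ext (bal2 (t + b)) (bal3 (z + e)) := by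
  funext ⟨s, c⟩
  have hs : bal2 (s + b) = t ↔ (s : ℤ) = bal2 (t + b) := by
    unfold bal2
    omega
  have hc : bal3 (z - bal3 ((c : ℤ) - 1 - e)) = bal3 (bal3 (z + e) - ((c : ℤ) - 1)) := by
    unfold bal3
    split_ifs <;> omega
  simp only [psi, ext, slot2_coe, slot3_coe, hs, hc]

theorem PsiMix_injective {m₁ m₂ : ℕ} (b : Fin m₁ → ℤ) (e : Fin m₂ → ℤ) :
    Function.Injective (PsiMix b e) := by
  intro v w h
  funext ⟨i, j, q⟩
  have hblock : (fun q => v (i, j, q)) = fun q => w (i, j, q) :=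
    psi_injective (b i) (e j) (funext fun q => congrFun h (i, j, q))
  exact congrFun hblock q

theorem PsiMix_ExtMix {m₁ m₂ : ℕ} {t : Fin m₁ → ℤ} (ht : ∀ i, t i = 0 ∨ t i = 1)
    (b : Fin m₁ → ℤ) (z e : Fin m₂ → ℤ) :
    PsiMix b e (ExtMix t z) =
      ExtMix (fun i => bal2 (t i + b i)) (fun j => bal3 (z j + e j)) := by
  funext ⟨i, j, q⟩
  exact congrFun (psi_ext (ht i) (b i) (z j) (e j)) q

/-- For all `t, b ∈ {0,1}^{m₁}`, all `z, e ∈ {-1,0,1}^{m₂}`, and all `v ∈ ℤ^{6m₁m₂}`: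
`v = Ext(mix(t, z))` iff `Ψ_{b,e}(v) = Ext(mix(t ⊕ b, [z + e]₃))`. -/
theorem ExtMix_PsiMix_equiv (m₁ m₂ : ℕ) (hm₁ : 0 < m₁) (hm₂ : 0 < m₂)
    (t b : Fin m₁ → ℤ) (z e : Fin m₂ → ℤ)
    (ht : ∀ i, t i = 0 ∨ t i = 1) (hb : ∀ i, b i = 0 ∨ b i = 1)
    (hz : ∀ j, z j = -1 ∨ z j = 0 ∨ z j = 1) (he : ∀ j, e j = -1 ∨ e j = 0 ∨ e j = 1)
    (v : Fin m₁ × Fin m₂ × Fin 2 × Fin 3 → ℤ) :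
    v = ExtMix t z ↔
      PsiMix b e v = ExtMix (fun i => bal2 (t i + b i)) (fun j => bal3 (z j + e j)) := by
  rw [← PsiMix_ExtMix ht b z e, (PsiMix_injective b e).eq_iff]
end
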